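/- arXiv:1405.4217 — 7 statements merged into one kernel-verified Lean document; each statement's English description precedes it below -/
import Mathlib

section
/- Let p be a prime, r ≥ 1, and f a monic irreducible polynomial of degree r over ZMod p satisfying condition (G): the smallest positive integer a with X^a ≡ 1 (mod f) in (ZMod p)[X] is p^r − 1. Let A be a matrix over ZMod p with characteristic polynomial f. Then A^(p^r − 1) = 1, and A^k ≠ 1 for every integer k with 0 < k < p^r − 1; that is, the order of A in GL_r(ZMod p) is exactly p^r − 1. -/
open Polynomial Matrix

/-- A matrix over a field with irreducible characteristic polynomial `f` is a root of exactly the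
multiples of `f`. -/
theorem Matrix.aeval_eq_zero_iff_charpoly_dvd {K n : Type*} [Field K] [Fintype n] [DecidableEq n]
    [Nonempty n] {A : Matrix n n K} (hirr : Irreducible A.charpoly) (g : K[X]) :
    aeval A g = 0 ↔ A.charpoly ∣ g := by
  rw [minpoly.eq_of_irreducible_of_monic hirr A.aeval_self_charpoly A.charpoly_monic]
  exact (minpoly.dvd_iff).symm

/-- If `f` is a monic irreducible polynomial of degree `r` over `ZMod p`
satisfying condition (G) (the order of `X` modulo `f` is `p^r - 1`), and `A` has
characteristic polynomial `f`, then `A` has order exactly `p^r - 1`. -/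
theorem stmt_2 (p : ℕ) [Fact p.Prime] (r : ℕ) (hr : 1 ≤ r)
    (f : Polynomial (ZMod p)) (hmonic : f.Monic) (hirr : Irreducible f)
    (hdeg : f.natDegree = r)
    (hG1 : f ∣ X ^ (p ^ r - 1) - 1)
    (hG2 : ∀ a : ℕ, 0 < a → a < p ^ r - 1 → ¬ f ∣ X ^ a - 1)
    (A : Matrix (Fin r) (Fin r) (ZMod p)) (hA : A.charpoly = f) :
    A ^ (p ^ r - 1) = 1 ∧ ∀ k : ℕ, 0 < k → k < p ^ r - 1 → A ^ k ≠ 1 := by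
  have : Nonempty (Fin r) := ⟨⟨0, hr⟩⟩
  have key (k : ℕ) : A ^ k = 1 ↔ f ∣ X ^ k - 1 := by
    rw [← hA, ← aeval_eq_zero_iff_charpoly_dvd (hA ▸ hirr)]
    simp [sub_eq_zero]
  exact ⟨(key _).2 hG1, fun k hk hlt h => hG2 k hk hlt ((key k).1 h)⟩
end

section
/- Let p be a prime, r ≥ 1, and f a monic irreducible polynomial of degree r over ZMod p satisfying condition (G): the smallest positive integer a with X^a ≡ 1 (mod f) in (ZMod p)[X] is p^r − 1. Let A be a matrix over ZMod p with characteristic polynomial f and let b : Fin r → ZMod p be a nonzero vector. Then the map t ↦ A^t · b, for t ∈ {0, 1, …, p^r − 2}, is a bijection onto the set of nonzero vectors of (Fin r → ZMod p). -/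
open Polynomial Matrix

/-- If the characteristic polynomial of `A` is irreducible and does not divide `g`, then `g(A)` has
trivial kernel. -/
theorem Matrix.eq_zero_of_aeval_mulVec_eq_zero {K n : Type*} [Field K] [Fintype n] [DecidableEq n]
    {A : Matrix n n K} (hA : Irreducible A.charpoly) {g : K[X]} (hg : ¬ A.charpoly ∣ g)
    {v : n → K} (hv : aeval A g *ᵥ v = 0) : v = 0 := by
  obtain ⟨u, w, h⟩ := (hA.coprime_iff_not_dvd).2 hg
  have h' := congrArg (fun q => aeval A q *ᵥ v) h
  simpa [Matrix.aeval_self_charpoly, ← Matrix.mulVec_mulVec, hv] using h'.symm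

/-- Under condition (G), the map `t ↦ A^t ⬝ b` for `t ∈ {0, …, p^r - 2}`
is a bijection onto the nonzero vectors of `(Fin r → ZMod p)`. -/
theorem stmt_3 (p : ℕ) [Fact p.Prime] (r : ℕ) (hr : 1 ≤ r)
    (f : Polynomial (ZMod p)) (hmonic : f.Monic) (hirr : Irreducible f)
    (hdeg : f.natDegree = r)
    (hG1 : f ∣ X ^ (p ^ r - 1) - 1)
    (hG2 : ∀ a : ℕ, 0 < a → a < p ^ r - 1 → ¬ f ∣ X ^ a - 1)
    (A : Matrix (Fin r) (Fin r) (ZMod p)) (hA : A.charpoly = f)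
    (b : Fin r → ZMod p) (hb : b ≠ 0) :
    Set.BijOn (fun t : ℕ => (A ^ t).mulVec b)
      {t : ℕ | t < p ^ r - 1} {v : Fin r → ZMod p | v ≠ 0} := by
  subst hA
  have hN : p ^ r - 1 ≠ 0 := by
    have := Nat.one_lt_pow (by omega : r ≠ 0) (Fact.out : p.Prime).one_lt
    omega
  have hX (t : ℕ) : ¬ A.charpoly ∣ X ^ t := fun h => by
    have h1 := dvd_pow (hirr.prime.dvd_of_dvd_pow h) hN
    exact hirr.not_isUnit (isUnit_of_dvd_one (by simpa using dvd_sub h1 hG1))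
  have hmaps : ∀ t : ℕ, (A ^ t) *ᵥ b ≠ 0 := fun t h =>
    hb (Matrix.eq_zero_of_aeval_mulVec_eq_zero hirr (hX t) (by simpa using h))
  have hne : ∀ s t : ℕ, s < t → t < p ^ r - 1 → (A ^ s) *ᵥ b ≠ (A ^ t) *ᵥ b := by
    intro s t hst ht h
    refine hmaps s (Matrix.eq_zero_of_aeval_mulVec_eq_zero hirr
      (hG2 (t - s) (by omega) (by omega)) ?_)
    simp only [map_sub, map_pow, aeval_X, map_one, Matrix.mulVec_mulVec]
    rw [sub_mul, one_mul, ← pow_add, Matrix.sub_mulVec, Nat.sub_add_cancel hst.le, h, sub_self]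
  have hinj : Set.InjOn (fun t : ℕ => (A ^ t) *ᵥ b) (Finset.range (p ^ r - 1)) := by
    intro s hs t ht h
    simp only [Finset.coe_range, Set.mem_Iio] at hs ht
    rcases lt_trichotomy s t with hst | hst | hst
    · exact (hne s t hst ht h).elim
    · exact hst
    · exact (hne t s hst hs h.symm).elim
  have hsurj := Finset.surjOn_of_injOn_of_card_le (s := Finset.range (p ^ r - 1))
    (t := Finset.univ.erase (0 : Fin r → ZMod p)) (fun t : ℕ => (A ^ t) *ᵥ b)
    (fun t _ => by simpa using hmaps t) hinj
    (by simp [Finset.card_erase_of_mem, ZMod.card])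
  refine ⟨fun t _ => hmaps t, fun s hs t ht h => hinj (by simpa using hs) (by simpa using ht) h,
    fun v hv => ?_⟩
  obtain ⟨t, ht, rfl⟩ := hsurj (show v ∈ _ by simpa using hv)
  exact ⟨t, by simpa using ht, rfl⟩
end

section
/- Let p be a prime, r ≥ 1, and f a monic irreducible polynomial of degree r over ZMod p satisfying condition (G) (the order of X modulo f is p^r − 1). Let A be a matrix over ZMod p with characteristic polynomial f, b₀ a nonzero vector, and define b : ℕ → (Fin r → ZMod p) by b(t) = 0 if p^r divides t, and b(t) = A^((t mod p^r) − 1) · b₀ otherwise. Then the restriction of b to {0, 1, …, p^r − 1} is a bijection onto (Fin r → ZMod p); in particular, in one period of length p^r, b takes every value in (ZMod p)^r exactly once, and b(T) ≠ 0 for every T with 0 < T < p^r. -/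
open Polynomial Matrix

/-- A polynomial in `A` that is not divisible by an irreducible polynomial annihilating `A`
acts injectively. -/
theorem dvd_of_aeval_mulVec_eq_zero {K n : Type*} [Field K] [Fintype n] [DecidableEq n]
    {f g : K[X]} (hf : Irreducible f) {A : Matrix n n K} (hA : aeval A f = 0) {v : n → K}
    (hv : v ≠ 0) (h : (aeval A g) *ᵥ v = 0) : f ∣ g := by
  by_contra hfg
  obtain ⟨c, d, hcd⟩ := (hf.coprime_iff_not_dvd).2 hfg
  have h1 := congrArg (fun q => (aeval A q) *ᵥ v) hcd
  simp only [map_add, map_mul, hA, mul_zero, zero_add, map_one, one_mulVec,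
    ← mulVec_mulVec, h, mulVec_zero] at h1
  exact hv h1.symm

theorem not_dvd_X_pow_of_dvd_X_pow_sub_one {K : Type*} [Field K] {f : K[X]} (hf : Irreducible f)
    {m : ℕ} (hm : m ≠ 0) (h : f ∣ X ^ m - 1) (n : ℕ) : ¬ f ∣ X ^ n := by
  intro hn
  have h1 : f ∣ X ^ m := dvd_pow (hf.prime.dvd_of_dvd_pow hn) hm
  have h2 : f ∣ 1 := by simpa using dvd_sub h1 h
  exact hf.not_isUnit (isUnit_of_dvd_one h2)

/-- Under condition (G), with `b t = 0` if `p^r ∣ t` and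
`b t = A^((t % p^r) - 1) ⬝ b₀` otherwise, the restriction of `b` to
`{0, …, p^r - 1}` is a bijection onto `(Fin r → ZMod p)`; in particular `b` takes
every value exactly once in a period and `b T ≠ 0` for `0 < T < p^r`. -/
theorem stmt_4 (p : ℕ) [Fact p.Prime] (r : ℕ) (hr : 1 ≤ r)
    (f : Polynomial (ZMod p)) (hmonic : f.Monic) (hirr : Irreducible f)
    (hdeg : f.natDegree = r)
    (hG1 : f ∣ X ^ (p ^ r - 1) - 1)
    (hG2 : ∀ a : ℕ, 0 < a → a < p ^ r - 1 → ¬ f ∣ X ^ a - 1)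
    (A : Matrix (Fin r) (Fin r) (ZMod p)) (hA : A.charpoly = f)
    (b₀ : Fin r → ZMod p) (hb₀ : b₀ ≠ 0)
    (b : ℕ → (Fin r → ZMod p))
    (hb : ∀ t : ℕ, b t = if p ^ r ∣ t then 0 else (A ^ (t % p ^ r - 1)).mulVec b₀) :
    Set.BijOn b {t : ℕ | t < p ^ r} Set.univ ∧
      ∀ T : ℕ, 0 < T → T < p ^ r → b T ≠ 0 := by
  have hAf : aeval A f = 0 := hA ▸ A.aeval_self_charpoly
  have hcard : 1 < p ^ r := Nat.one_lt_pow (by omega) (Fact.out : p.Prime).one_lt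
  have hX := not_dvd_X_pow_of_dvd_X_pow_sub_one hirr (by omega) hG1
  have hb_zero : b 0 = 0 := by simp [hb]
  have hb_pos : ∀ T : ℕ, 0 < T → T < p ^ r → b T = (A ^ (T - 1)) *ᵥ b₀ := by
    intro T hT hTr
    rw [hb, if_neg (Nat.not_dvd_of_pos_of_lt hT hTr), Nat.mod_eq_of_lt hTr]
  have hb_ne : ∀ T : ℕ, 0 < T → T < p ^ r → b T ≠ 0 := by
    intro T hT hTr h
    rw [hb_pos T hT hTr] at h
    exact hX (T - 1) (dvd_of_aeval_mulVec_eq_zero hirr hAf hb₀ (by simpa using h))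
  have hb_lt : ∀ s t : ℕ, s < t → t < p ^ r → b s ≠ b t := by
    intro s t hst ht h
    rcases Nat.eq_zero_or_pos s with rfl | hs
    · exact hb_ne t hst ht (h ▸ hb_zero)
    rw [hb_pos s hs (hst.trans ht), hb_pos t (hs.trans hst) ht] at h
    have hdvd : f ∣ X ^ (s - 1) * (X ^ (t - s) - 1) := by
      refine dvd_of_aeval_mulVec_eq_zero hirr hAf hb₀ ?_
      rw [mul_sub, mul_one, ← pow_add, show s - 1 + (t - s) = t - 1 by omega]
      simp [sub_mulVec, h]
    exact (hirr.prime.dvd_or_dvd hdvd).elim (hX _) (hG2 _ (by omega) (by omega))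
  have hinj : Function.Injective fun i : Fin (p ^ r) => b i := by
    intro i j hij
    rcases lt_trichotomy i j with h | h | h
    · exact (hb_lt i j h j.2 hij).elim
    · exact h
    · exact (hb_lt j i h i.2 hij.symm).elim
  have hbij := (Fintype.bijective_iff_injective_and_card _).2
    ⟨hinj, by simp [ZMod.card]⟩
  refine ⟨⟨fun _ _ => Set.mem_univ _, fun s hs t ht hst => ?_, fun v _ => ?_⟩, hb_ne⟩
  · exact congrArg Fin.val (@hinj ⟨s, hs⟩ ⟨t, ht⟩ hst)
  · obtain ⟨i, hi⟩ := hbij.2 v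
    exact ⟨i, i.2, hi⟩
end

section
/- Let p be a prime, r ≥ 1, and f a monic irreducible polynomial of degree r over ZMod p satisfying condition (G) (the order of X modulo f is p^r − 1). Let A be a matrix over ZMod p with characteristic polynomial f, b₀ a nonzero vector, and define b : ℕ → (Fin r → ZMod p) by b(t) = 0 if p^r divides t, and b(t) = A^((t mod p^r) − 1) · b₀ otherwise. Then for every t ∈ ℕ, the (r+1) × (r+1) matrix over ZMod p whose first row is (1, 1, …, 1) and whose remaining rows are given by the column vectors b(t), b(t+1), …, b(t+r) is invertible. -/
open Polynomial Matrix

/-- A monic polynomial of degree `n` divides no nonzero polynomial of degree less than `n`. -/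
theorem eq_zero_of_monic_dvd_sum_fin {R : Type*} [CommRing R] [Nontrivial R] {n : ℕ} {g : R[X]}
    (hg : g.Monic) (hdeg : g.natDegree = n) (c : Fin n → R)
    (h : g ∣ ∑ j : Fin n, C (c j) * X ^ (j : ℕ)) : c = 0 := by
  have hlt : (∑ j : Fin n, C (c j) * X ^ (j : ℕ)).degree < g.degree := by
    rw [degree_eq_natDegree hg.ne_zero, hdeg]
    exact degree_sum_fin_lt c
  have hzero : ∑ j : Fin n, C (c j) * X ^ (j : ℕ) = 0 :=
    by_contra fun hne => hg.not_dvd_of_degree_lt hne hlt h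
  funext i
  have hcoeff := congrArg (fun q => coeff q (i : ℕ)) hzero
  simpa [finsetSum_coeff, coeff_C_mul, coeff_X_pow, Fin.val_inj] using hcoeff

/-- If the characteristic polynomial of `A` is irreducible, then it divides every polynomial `q`
such that `q(A)` kills some nonzero vector. -/
theorem charpoly_dvd_of_aeval_mulVec_eq_zero {K n : Type*} [Field K] [Fintype n] [DecidableEq n]
    {A : Matrix n n K} (hA : Irreducible A.charpoly) {v : n → K} (hv : v ≠ 0) {q : K[X]}
    (h : (aeval A q).mulVec v = 0) : A.charpoly ∣ q := by
  by_contra hq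
  obtain ⟨a, b, hab⟩ := (hA.coprime_iff_not_dvd).2 hq
  apply hv
  have hone := congrArg (fun s => (aeval A s).mulVec v) hab
  simpa [A.aeval_self_charpoly, ← mulVec_mulVec, h] using hone.symm

/-- If the characteristic polynomial of `A` is irreducible and does not divide `X`, then it divides
the polynomial with coefficients `c` of any linear relation between the vectors `A ^ (m + j) v`. -/
theorem charpoly_dvd_of_sum_smul_pow_mulVec_eq_zero {K n : Type*} [Field K] [Fintype n]
    [DecidableEq n] {A : Matrix n n K} (hA : Irreducible A.charpoly) (hX : ¬ A.charpoly ∣ X)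
    {v : n → K} (hv : v ≠ 0) {s : ℕ} (m : ℕ) (c : Fin s → K)
    (h : ∑ j : Fin s, c j • (A ^ (m + j)).mulVec v = 0) :
    A.charpoly ∣ ∑ j : Fin s, C (c j) * X ^ (j : ℕ) := by
  have hdvd : A.charpoly ∣ X ^ m * ∑ j : Fin s, C (c j) * X ^ (j : ℕ) := by
    apply charpoly_dvd_of_aeval_mulVec_eq_zero hA hv
    rw [← h, Finset.mul_sum, map_sum, sum_mulVec]
    refine Finset.sum_congr rfl fun j _ => ?_
    rw [mul_left_comm, ← pow_add, map_mul, aeval_C, map_pow, aeval_X, ← Algebra.smul_def,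
      smul_mulVec]
  exact (hA.prime.dvd_or_dvd hdvd).resolve_left fun hm => hX (hA.prime.dvd_of_dvd_pow hm)

/-- Under condition (G), for every `t` the `(r+1) × (r+1)` matrix whose
columns are `(1, b(t+k))` for `k = 0, …, r` is invertible. -/
theorem stmt_5 (p : ℕ) [Fact p.Prime] (r : ℕ) (hr : 1 ≤ r)
    (f : Polynomial (ZMod p)) (hmonic : f.Monic) (hirr : Irreducible f)
    (hdeg : f.natDegree = r)
    (hG1 : f ∣ X ^ (p ^ r - 1) - 1)
    (hG2 : ∀ a : ℕ, 0 < a → a < p ^ r - 1 → ¬ f ∣ X ^ a - 1)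
    (A : Matrix (Fin r) (Fin r) (ZMod p)) (hA : A.charpoly = f)
    (b₀ : Fin r → ZMod p) (hb₀ : b₀ ≠ 0)
    (b : ℕ → (Fin r → ZMod p))
    (hb : ∀ t : ℕ, b t = if p ^ r ∣ t then 0 else (A ^ (t % p ^ r - 1)).mulVec b₀)
    (t : ℕ) :
    IsUnit (Matrix.of fun (i k : Fin (r + 1)) =>
      Fin.cons (1 : ZMod p) (b (t + (k : ℕ))) i) := by
  subst hA
  have hrN : r < p ^ r := Nat.lt_pow_self (Fact.out : p.Prime).one_lt
  generalize p ^ r = N at *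
  have hX : ¬ A.charpoly ∣ X := fun h =>
    hirr.not_isUnit <| isUnit_of_dvd_one <|
      (dvd_sub_right (h.trans (dvd_pow_self X (by omega)))).1 hG1
  have hAN : A ^ (N - 1) = 1 := by
    obtain ⟨q, hq⟩ := hG1
    have := congrArg (aeval A) hq
    simpa [A.aeval_self_charpoly, sub_eq_zero] using this
  rw [← mulVec_injective_iff_isUnit, ← coe_mulVecLin, ← LinearMap.ker_eq_bot,
    LinearMap.ker_eq_bot']
  intro c hc
  have hsum : ∑ k, c k = 0 := by
    simpa [mulVec, dotProduct] using congrFun hc 0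
  have hrel : ∑ k : Fin (r + 1), c k • b (t + k) = 0 := by
    funext i
    simpa [mulVec, dotProduct, mul_comm] using congrFun hc i.succ
  by_cases hwin : ∃ k₀ : Fin (r + 1), N ∣ t + k₀
  · obtain ⟨k₀, hk₀⟩ := hwin
    have hval : ∀ j : Fin r,
        b (t + (k₀.succAbove j : ℕ)) = (A ^ (N - 1 - k₀ + j)).mulVec b₀ := by
      intro j
      obtain ⟨d, hd⟩ := hk₀
      have hj := j.isLt
      have hk := k₀.isLt
      rcases lt_or_ge (j : ℕ) k₀ with hlt | hge
      · have hs : (k₀.succAbove j : ℕ) = j := by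
          rw [Fin.succAbove_of_castSucc_lt _ _ (by simpa [Fin.lt_def] using hlt)]
          simp
        obtain ⟨e, rfl⟩ : ∃ e, d = e + 1 :=
          Nat.exists_eq_succ_of_ne_zero (by rintro rfl; omega)
        have hmod : (t + j) % N = N - k₀ + j := by
          rw [show t + (j : ℕ) = (N - k₀ + j) + N * e by rw [mul_add] at hd; omega,
            Nat.add_mul_mod_self_left, Nat.mod_eq_of_lt (by omega)]
        rw [hs, hb, if_neg (by rw [Nat.dvd_iff_mod_eq_zero]; omega), hmod]
        congr 2
        omega
      · have hs : (k₀.succAbove j : ℕ) = j + 1 := by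
          rw [Fin.succAbove_of_le_castSucc _ _ (by simpa [Fin.le_def] using hge)]
          simp
        have hmod : (t + (j + 1)) % N = j + 1 - k₀ := by
          rw [show t + ((j : ℕ) + 1) = (j + 1 - k₀) + N * d by omega,
            Nat.add_mul_mod_self_left, Nat.mod_eq_of_lt (by omega)]
        rw [hs, hb, if_neg (by rw [Nat.dvd_iff_mod_eq_zero]; omega), hmod,
          show N - 1 - (k₀ : ℕ) + j = (N - 1) + (j + 1 - k₀ - 1) by omega, pow_add, hAN, one_mul]
    rw [Fin.sum_univ_succAbove _ k₀, hb (t + k₀), if_pos hk₀, smul_zero, zero_add] at hrel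
    simp only [hval] at hrel
    have hc0 := eq_zero_of_monic_dvd_sum_fin hmonic hdeg _
      (charpoly_dvd_of_sum_smul_pow_mulVec_eq_zero hirr hX hb₀ _
        (fun j => c (k₀.succAbove j)) hrel)
    rw [Fin.sum_univ_succAbove _ k₀, Finset.sum_eq_zero fun j _ => congrFun hc0 j,
      add_zero] at hsum
    funext k
    rcases Fin.eq_self_or_eq_succAbove k₀ k with rfl | ⟨j, rfl⟩
    · exact hsum
    · exact congrFun hc0 j
  · push Not at hwin
    have ht0 : t % N ≠ 0 := fun h => hwin 0 (by simpa using Nat.dvd_of_mod_eq_zero h)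
    have htN : t % N < N := Nat.mod_lt _ (by omega)
    have hdiv := Nat.mod_add_div t N
    have htr : t % N + r < N := by
      by_contra! hle
      refine hwin ⟨N - t % N, by omega⟩ ⟨t / N + 1, ?_⟩
      rw [mul_add]
      simp only
      omega
    have hval : ∀ k : Fin (r + 1), b (t + k) = (A ^ (t % N - 1 + k)).mulVec b₀ := by
      intro k
      have hk := k.isLt
      have hmod : (t + k) % N = t % N + k := by
        rw [show t + (k : ℕ) = t % N + k + N * (t / N) by omega,
          Nat.add_mul_mod_self_left, Nat.mod_eq_of_lt (by omega)]
      rw [hb, if_neg (hwin k), hmod]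
      congr 2
      omega
    simp only [hval] at hrel
    have hdvd := charpoly_dvd_of_sum_smul_pow_mulVec_eq_zero hirr hX hb₀ _ c hrel
    have hdvd_one : (X - C 1 : (ZMod p)[X]) ∣ ∑ k : Fin (r + 1), C (c k) * X ^ (k : ℕ) := by
      rw [dvd_iff_isRoot, IsRoot.def, eval_finsetSum]
      simpa using hsum
    have hcop : IsCoprime A.charpoly (X - C 1) := by
      rw [hirr.coprime_iff_not_dvd]
      simpa using hG2 1 one_pos (by omega)
    refine eq_zero_of_monic_dvd_sum_fin (hmonic.mul (monic_X_sub_C 1)) ?_ c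
      (hcop.mul_dvd hdvd hdvd_one)
    rw [hmonic.natDegree_mul (monic_X_sub_C 1), hdeg, natDegree_X_sub_C]
end

section
/- Let p be a prime, r ≥ 1, f a monic irreducible polynomial of degree r over ZMod p satisfying condition (G), A a matrix over ZMod p with characteristic polynomial f, b₀ a nonzero vector, and b : ℕ → (Fin r → ZMod p) defined by b(t) = 0 if p^r ∣ t and b(t) = A^((t mod p^r) − 1) · b₀ otherwise. Let S be a finite set, j₀ : S → ZMod p and α : S → (Fin r → ZMod p) maps such that s ↦ (j₀ s, α s) is injective, and define the time coordinate j(t)(s) = j₀ s + ⟪α s, b(t)⟫ (dot product over ZMod p). Then there do not exist distinct s, s' ∈ S and t ∈ ℕ with j(t+k)(s) = j(t+k)(s') for all k = 0, 1, …, r; i.e. the maximal continual collision number of this pattern is at most r, so it is a local good pattern. -/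
open Polynomial Matrix

section CyclicVector

variable {K : Type*} [Field K] {r : ℕ} {A : Matrix (Fin r) (Fin r) K}

theorem aeval_eq_zero_of_charpoly_dvd {g : K[X]} (h : A.charpoly ∣ g) : aeval A g = 0 := by
  obtain ⟨u, rfl⟩ := h
  rw [map_mul, Matrix.aeval_self_charpoly, zero_mul]

theorem charpoly_dvd_of_aeval_mulVec_eq_zero_s6 (hirr : Irreducible A.charpoly)
    {v : Fin r → K} (hv : v ≠ 0) {g : K[X]} (hg : aeval A g *ᵥ v = 0) : A.charpoly ∣ g := by
  by_contra hnd
  obtain ⟨u, w, huw⟩ := hirr.coprime_iff_not_dvd.2 hnd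
  apply hv
  have h := congrArg (fun q => aeval A q *ᵥ v) huw
  simpa [Matrix.aeval_self_charpoly, ← Matrix.mulVec_mulVec, hg] using h.symm

theorem linearIndependent_pow_mulVec (hirr : Irreducible A.charpoly)
    {v : Fin r → K} (hv : v ≠ 0) :
    LinearIndependent K (fun i : Fin r => A ^ (i : ℕ) *ᵥ v) := by
  rw [Fintype.linearIndependent_iff]
  intro c hc i
  let g : K[X] := ∑ i : Fin r, C (c i) * X ^ (i : ℕ)
  have hg : aeval A g *ᵥ v = 0 := by
    simpa [g, Matrix.sum_mulVec, ← Algebra.smul_def, Matrix.smul_mulVec] using hc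
  have hdeg : g.degree < A.charpoly.degree := by
    rw [Matrix.charpoly_degree_eq_dim, Fintype.card_fin]
    exact degree_sum_fin_lt c
  have hzero : g = 0 :=
    eq_zero_of_dvd_of_degree_lt (charpoly_dvd_of_aeval_mulVec_eq_zero_s6 hirr hv hg) hdeg
  have hcoeff : g.coeff i = c i := by
    simp [g, coeff_X_pow, Fin.val_inj]
  rw [← hcoeff, hzero, coeff_zero]

theorem eq_zero_of_dotProduct_pow_mulVec_eq_zero (hirr : Irreducible A.charpoly)
    {v β : Fin r → K} (hv : v ≠ 0) (h : ∀ i < r, β ⬝ᵥ (A ^ i *ᵥ v) = 0) : β = 0 := by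
  have hspan := (linearIndependent_pow_mulVec hirr hv).span_eq_top_of_card_eq_finrank' (by simp)
  refine dotProduct_eq_zero β fun x => ?_
  have hx : x ∈ Submodule.span K (Set.range fun i : Fin r => A ^ (i : ℕ) *ᵥ v) := by
    rw [hspan]; trivial
  induction hx using Submodule.span_induction with
  | mem x hx => obtain ⟨i, rfl⟩ := hx; exact h i i.2
  | zero => simp
  | add x y _ _ hx hy => rw [dotProduct_add, hx, hy, add_zero]
  | smul a x _ hx => rw [dotProduct_smul, hx, smul_zero]

end CyclicVector

/-- the new hopping pattern is a local good pattern: there are no `r+1`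
consecutive collisions between two distinct resources. -/
theorem stmt_6 (p : ℕ) [Fact p.Prime] (r : ℕ) (hr : 1 ≤ r)
    (f : Polynomial (ZMod p)) (hmonic : f.Monic) (hirr : Irreducible f)
    (hdeg : f.natDegree = r)
    (hG1 : f ∣ X ^ (p ^ r - 1) - 1)
    (hG2 : ∀ a : ℕ, 0 < a → a < p ^ r - 1 → ¬ f ∣ X ^ a - 1)
    (A : Matrix (Fin r) (Fin r) (ZMod p)) (hA : A.charpoly = f)
    (b₀ : Fin r → ZMod p) (hb₀ : b₀ ≠ 0)
    (b : ℕ → (Fin r → ZMod p))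
    (hb : ∀ t : ℕ, b t = if p ^ r ∣ t then 0 else (A ^ (t % p ^ r - 1)).mulVec b₀)
    (S : Type*) [Fintype S]
    (j₀ : S → ZMod p) (α : S → (Fin r → ZMod p))
    (hinj : Function.Injective (fun s => (j₀ s, α s)))
    (j : ℕ → S → ZMod p)
    (hj : ∀ t s, j t s = j₀ s + ∑ k : Fin r, α s k * b t k) :
    ¬ ∃ (s s' : S) (t : ℕ), s ≠ s' ∧ ∀ k : ℕ, k ≤ r → j (t + k) s = j (t + k) s' := by
  rintro ⟨s, s', t, hne, hcol⟩
  subst hA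
  set β := α s - α s' with hβ
  have hβcol : ∀ k ≤ r, j₀ s - j₀ s' + β ⬝ᵥ b (t + k) = 0 := by
    intro k hk
    have h := hcol k hk
    rw [hj, hj] at h
    change j₀ s + α s ⬝ᵥ b (t + k) = j₀ s' + α s' ⬝ᵥ b (t + k) at h
    rw [hβ, sub_dotProduct]
    linear_combination h
  suffices h : β = 0 by
    have h0 := hβcol 0 (Nat.zero_le r)
    rw [h, zero_dotProduct, add_zero] at h0
    exact hne (hinj (Prod.ext (sub_eq_zero.1 h0) (sub_eq_zero.1 h)))
  have hq : r < p ^ r := Nat.lt_pow_self (Fact.out : p.Prime).one_lt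
  have hAq : A ^ (p ^ r - 1) = 1 := by
    have h := aeval_eq_zero_of_charpoly_dvd hG1
    rw [map_sub, map_pow, aeval_X, map_one] at h
    exact sub_eq_zero.1 h
  have hAunit : IsUnit A := IsUnit.of_pow_eq_one hAq (by omega)
  have hpow : ∀ n, A ^ n *ᵥ b₀ ≠ 0 := fun n h =>
    hb₀ (Matrix.mulVec_injective_of_isUnit (hAunit.pow n) (h.trans (mulVec_zero _).symm))
  by_cases hmul : ∃ k ≤ r, p ^ r ∣ t + k
  · obtain ⟨k₀, hk₀, d, hd⟩ := hmul
    have hj₀ : j₀ s - j₀ s' = 0 := by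
      have h := hβcol k₀ hk₀
      rwa [hb, if_pos ⟨d, hd⟩, dotProduct_zero, add_zero] at h
    refine eq_zero_of_dotProduct_pow_mulVec_eq_zero hirr (hpow (p ^ r - 1 - k₀)) fun i hi => ?_
    rw [mulVec_mulVec, ← pow_add]
    rcases lt_or_ge i k₀ with hik | hik
    · have h := hβcol i hi.le
      have hmod : (t + i) % p ^ r = p ^ r - (k₀ - i) := by
        have hd1 : 1 ≤ d := by
          rcases Nat.eq_zero_or_pos d with rfl | h0
          · omega
          · exact h0
        obtain ⟨e, rfl⟩ := Nat.exists_eq_add_of_le' hd1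
        have : t + i = p ^ r - (k₀ - i) + p ^ r * e := by
          rw [mul_add, mul_one] at hd; omega
        rw [this, Nat.add_mul_mod_self_left, Nat.mod_eq_of_lt (by omega)]
      rw [hb, if_neg (by rw [Nat.dvd_iff_mod_eq_zero, hmod]; omega), hmod, hj₀, zero_add] at h
      rwa [show i + (p ^ r - 1 - k₀) = p ^ r - (k₀ - i) - 1 by omega]
    · have h := hβcol (i + 1) hi
      have hmod : (t + (i + 1)) % p ^ r = i + 1 - k₀ := by
        have : t + (i + 1) = i + 1 - k₀ + p ^ r * d := by omega
        rw [this, Nat.add_mul_mod_self_left, Nat.mod_eq_of_lt (by omega)]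
      rw [hb, if_neg (by rw [Nat.dvd_iff_mod_eq_zero, hmod]; omega), hmod, hj₀, zero_add] at h
      rwa [show i + (p ^ r - 1 - k₀) = p ^ r - 1 + (i + 1 - k₀ - 1) by omega, pow_add, hAq,
        one_mul]
  · push Not at hmul
    have hmod_ne : t % p ^ r ≠ 0 := fun h =>
      hmul 0 (Nat.zero_le r) (Nat.dvd_of_mod_eq_zero h)
    have hmod_lt : t % p ^ r + r < p ^ r := by
      by_contra hge
      have hlt := Nat.mod_lt t (Nat.zero_lt_of_lt hq)
      refine hmul (p ^ r - t % p ^ r) (by omega) ⟨t / p ^ r + 1, ?_⟩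
      have := Nat.mod_add_div t (p ^ r)
      rw [mul_add, mul_one]
      omega
    obtain ⟨m, hm⟩ : ∃ m, t % p ^ r = m + 1 := Nat.exists_eq_succ_of_ne_zero hmod_ne
    rw [hm] at hmod_lt
    set v := A ^ m *ᵥ b₀ with hv
    have hbv : ∀ k ≤ r, b (t + k) = A ^ k *ᵥ v := by
      intro k hk
      have hmod : (t + k) % p ^ r = m + 1 + k := by
        rw [Nat.add_mod, hm, Nat.mod_eq_of_lt (show k < p ^ r by omega), Nat.mod_eq_of_lt (by omega)]
      rw [hb, if_neg (hmul k hk), hmod, hv, mulVec_mulVec, ← pow_add]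
      congr 2
      omega
    have hw : (A - 1) *ᵥ v ≠ 0 := by
      intro h
      refine hG2 1 one_pos (by omega) ?_
      rw [pow_one]
      exact charpoly_dvd_of_aeval_mulVec_eq_zero_s6 hirr (hpow m) (by simpa [hv] using h)
    refine eq_zero_of_dotProduct_pow_mulVec_eq_zero hirr hw fun i hi => ?_
    have h := hβcol i hi.le
    have h' := hβcol (i + 1) hi
    rw [hbv i hi.le] at h
    rw [hbv (i + 1) hi] at h'
    rw [mulVec_mulVec, mul_sub, mul_one, ← pow_succ, sub_mulVec, dotProduct_sub]
    linear_combination h' - h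
end

section
/- Let p be a prime, r ≥ 1, f a monic irreducible polynomial of degree r over ZMod p satisfying condition (G), A a matrix over ZMod p with characteristic polynomial f, b₀ a nonzero vector, and b : ℕ → (Fin r → ZMod p) defined by b(t) = 0 if p^r ∣ t and b(t) = A^((t mod p^r) − 1) · b₀ otherwise. Let S be a finite set, j₀ : S → ZMod p and α : S → (Fin r → ZMod p) with s ↦ (j₀ s, α s) injective, and suppose that for each of the r+1 vectors v ∈ {0, e₁, …, e_r} (the zero vector and the standard basis vectors of (ZMod p)^r) there exists s ∈ S with j₀ s = 0 and α s = v. Define j(t)(s) = j₀ s + ⟪α s, b(t)⟫. Then: (1) for all s, s' ∈ S and t ∈ ℕ, j(t)(s) = j(t)(s') if and only if j(t + p^r)(s) = j(t + p^r)(s'); and (2) for every T with 0 < T < p^r there exist s, s' ∈ S and t ∈ ℕ with j(t)(s) = j(t)(s') but j(t + T)(s) ≠ j(t + T)(s'). That is, the column period of this pattern is exactly p^r. -/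
open Polynomial Matrix

/-- the column period of the new hopping pattern is exactly `p^r`:
(1) collisions at frame `t` and frame `t + p^r` occur simultaneously, and
(2) no positive `T < p^r` has this property. -/
theorem stmt_7 (p : ℕ) [Fact p.Prime] (r : ℕ) (hr : 1 ≤ r)
    (f : Polynomial (ZMod p)) (hmonic : f.Monic) (hirr : Irreducible f)
    (hdeg : f.natDegree = r)
    (hG1 : f ∣ X ^ (p ^ r - 1) - 1)
    (hG2 : ∀ a : ℕ, 0 < a → a < p ^ r - 1 → ¬ f ∣ X ^ a - 1)
    (A : Matrix (Fin r) (Fin r) (ZMod p)) (hA : A.charpoly = f)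
    (b₀ : Fin r → ZMod p) (hb₀ : b₀ ≠ 0)
    (b : ℕ → (Fin r → ZMod p))
    (hb : ∀ t : ℕ, b t = if p ^ r ∣ t then 0 else (A ^ (t % p ^ r - 1)).mulVec b₀)
    (S : Type*) [Fintype S]
    (j₀ : S → ZMod p) (α : S → (Fin r → ZMod p))
    (hinj : Function.Injective (fun s => (j₀ s, α s)))
    (h0 : ∃ s : S, j₀ s = 0 ∧ α s = 0)
    (hbasis : ∀ k : Fin r, ∃ s : S, j₀ s = 0 ∧ α s = Pi.single k 1)
    (j : ℕ → S → ZMod p)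
    (hj : ∀ t s, j t s = j₀ s + ∑ k : Fin r, α s k * b t k) :
    (∀ (s s' : S) (t : ℕ), j t s = j t s' ↔ j (t + p ^ r) s = j (t + p ^ r) s') ∧
      (∀ T : ℕ, 0 < T → T < p ^ r →
        ∃ (s s' : S) (t : ℕ), j t s = j t s' ∧ j (t + T) s ≠ j (t + T) s') := by
  have hq : 1 < p ^ r := Nat.one_lt_pow (by omega) (Fact.out : p.Prime).one_lt
  have hperiod : ∀ t, b (t + p ^ r) = b t := by
    intro t
    simp only [hb, Nat.add_mod_right, Nat.dvd_add_self_right]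
  refine ⟨fun s s' t => by simp only [hj, hperiod], fun T hT hTlt => ?_⟩
  have hpow : A ^ (p ^ r - 1) = 1 := by
    obtain ⟨g, hg⟩ := hG1
    have h := congrArg (aeval A) hg
    rw [map_mul, ← hA, aeval_self_charpoly, zero_mul] at h
    simpa [sub_eq_zero] using h
  have hunit : IsUnit A := IsUnit.of_pow_eq_one hpow (by omega)
  have hbT : b T ≠ 0 := by
    rw [hb, if_neg (Nat.not_dvd_of_pos_of_lt hT hTlt)]
    intro h
    exact hb₀ (mulVec_injective_of_isUnit (hunit.pow _) (h.trans (mulVec_zero _).symm))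
  obtain ⟨k, hk⟩ := Function.ne_iff.mp hbT
  obtain ⟨s, hs, hαs⟩ := hbasis k
  obtain ⟨s', hs', hαs'⟩ := h0
  have hb0 : b 0 = 0 := by simp [hb]
  refine ⟨s, s', 0, by simp [hj, hb0, hs, hs'], ?_⟩
  simpa [hj, hs, hs', hαs, hαs', Pi.single_apply] using hk
end

section
/- Let p be a prime, r ≥ 1, f a monic irreducible polynomial of degree r over ZMod p satisfying condition (G), A a matrix over ZMod p with characteristic polynomial f, b₀ a nonzero vector, and b : ℕ → (Fin r → ZMod p) defined by b(t) = 0 if p^r ∣ t and b(t) = A^((t mod p^r) − 1) · b₀ otherwise. Let S be a finite set, j₀ : S → ZMod p and α : S → (Fin r → ZMod p) with s ↦ (j₀ s, α s) injective, and define j(t)(s) = j₀ s + ⟪α s, b(t)⟫. Then for all distinct s, s' ∈ S, the number of t ∈ {0, 1, …, p^r − 1} with j(t)(s) = j(t)(s') equals 0 if α s = α s', and equals p^(r−1) if α s ≠ α s'. In particular the maximal collision ratio of this pattern is 1/p. -/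
open Polynomial Matrix

/-- A polynomial not divisible by an irreducible characteristic polynomial acts injectively. -/
lemma aeval_mulVec_ne_zero_of_irreducible_charpoly {K n : Type*} [Field K] [Fintype n]
    [DecidableEq n] {A : Matrix n n K} (hirr : Irreducible A.charpoly) {g : K[X]}
    (hg : ¬ A.charpoly ∣ g) {v : n → K} (hv : v ≠ 0) : (aeval A g) *ᵥ v ≠ 0 := by
  intro h
  obtain ⟨a, c, hac⟩ := (hirr.coprime_iff_not_dvd).2 hg
  have h1 := congrArg (aeval A) hac
  simp only [map_add, map_mul, Matrix.aeval_self_charpoly, mul_zero, zero_add, map_one] at h1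
  apply hv
  rw [← Matrix.one_mulVec v, ← h1, ← Matrix.mulVec_mulVec, h, Matrix.mulVec_zero]

/-- Every level set of a nonzero linear functional on `K ^ r` has `|K| ^ (r - 1)` elements. -/
lemma card_dotProduct_eq {K : Type*} [Field K] [Fintype K] [DecidableEq K] {r : ℕ}
    {β : Fin r → K} (hβ : β ≠ 0) (c : K) :
    (Finset.univ.filter (fun v : Fin r → K => β ⬝ᵥ v = c)).card = Fintype.card K ^ (r - 1) := by
  obtain ⟨i, hi⟩ := Function.ne_iff.1 hβ
  have hi' : β i ≠ 0 := hi
  let φ : (Fin r → K) →+ K :=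
    { toFun := fun v => β ⬝ᵥ v, map_zero' := dotProduct_zero _, map_add' := dotProduct_add _ }
  have hsurj : ∀ x, x ∈ Set.range φ := fun x =>
    ⟨Pi.single i ((β i)⁻¹ * x), by simp [φ, hi']⟩
  have hfib : ∀ x, (Finset.univ.filter (fun v => φ v = x)).card =
      (Finset.univ.filter (fun v => φ v = c)).card := fun x =>
    AddMonoidHom.card_fiber_eq_of_mem_range φ (hsurj x) (hsurj c)
  have htot := Finset.card_eq_sum_card_fiberwise (f := φ) (s := Finset.univ) (t := Finset.univ)
    (fun _ _ => Finset.mem_coe.2 (Finset.mem_univ _))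
  simp only [hfib, Finset.sum_const, Finset.card_univ, Fintype.card_fun, Fintype.card_fin,
    smul_eq_mul] at htot
  obtain ⟨k, rfl⟩ : ∃ k, r = k + 1 := ⟨r - 1, by have := i.2; omega⟩
  rw [pow_succ'] at htot
  exact (Nat.eq_of_mul_eq_mul_left Fintype.card_pos htot).symm

/-- If `X` has order at least `N` modulo the irreducible characteristic polynomial of `A`, then the
first `N` vectors `A ^ m *ᵥ v` of the orbit of `v ≠ 0` are distinct. -/
lemma pow_mulVec_injOn {K n : Type*} [Field K] [Fintype n] [DecidableEq n] {A : Matrix n n K}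
    (hirr : Irreducible A.charpoly) (hX : ¬ A.charpoly ∣ X) {N : ℕ}
    (hord : ∀ a : ℕ, 0 < a → a < N → ¬ A.charpoly ∣ X ^ a - 1) {v : n → K} (hv : v ≠ 0) :
    Set.InjOn (fun m => (A ^ m) *ᵥ v) (Set.Iio N) := by
  have key : ∀ m k, m < k → k < N → (A ^ m) *ᵥ v ≠ (A ^ k) *ᵥ v := by
    intro m k hmk hk h
    obtain ⟨d, rfl⟩ := Nat.exists_eq_add_of_lt hmk
    refine aeval_mulVec_ne_zero_of_irreducible_charpoly hirr (g := X ^ m * (X ^ (d + 1) - 1))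
      (fun hdvd => ?_) hv ?_
    · rcases hirr.prime.dvd_or_dvd hdvd with h | h
      · exact hX (hirr.prime.dvd_of_dvd_pow h)
      · exact hord (d + 1) (by omega) (by omega) h
    · simp only [map_sub, map_pow, aeval_X, mul_sub, mul_one, ← pow_add,
        Matrix.sub_mulVec]
      rw [h, ← add_assoc, sub_self]
  intro m hm k hk h
  rcases lt_trichotomy m k with hlt | heq | hgt
  · exact absurd h (key m k hlt hk)
  · exact heq
  · exact absurd h.symm (key k m hgt hm)

/-- for distinct resources `s, s'`, the number of collisions in one
period `{0, …, p^r - 1}` is `0` if `α s = α s'` and `p^(r-1)` otherwise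
(hence the maximal collision ratio is `1/p`). -/
theorem stmt_8 (p : ℕ) [Fact p.Prime] (r : ℕ) (hr : 1 ≤ r)
    (f : Polynomial (ZMod p)) (hmonic : f.Monic) (hirr : Irreducible f)
    (hdeg : f.natDegree = r)
    (hG1 : f ∣ X ^ (p ^ r - 1) - 1)
    (hG2 : ∀ a : ℕ, 0 < a → a < p ^ r - 1 → ¬ f ∣ X ^ a - 1)
    (A : Matrix (Fin r) (Fin r) (ZMod p)) (hA : A.charpoly = f)
    (b₀ : Fin r → ZMod p) (hb₀ : b₀ ≠ 0)
    (b : ℕ → (Fin r → ZMod p))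
    (hb : ∀ t : ℕ, b t = if p ^ r ∣ t then 0 else (A ^ (t % p ^ r - 1)).mulVec b₀)
    (S : Type*) [Fintype S] [DecidableEq S]
    (j₀ : S → ZMod p) (α : S → (Fin r → ZMod p))
    (hinj : Function.Injective (fun s => (j₀ s, α s)))
    (j : ℕ → S → ZMod p)
    (hj : ∀ t s, j t s = j₀ s + ∑ k : Fin r, α s k * b t k)
    (s s' : S) (hss' : s ≠ s') :
    ((Finset.range (p ^ r)).filter (fun t => j t s = j t s')).card =
      if α s = α s' then 0 else p ^ (r - 1) := by
  have hq : 1 < p ^ r := Nat.one_lt_pow (by omega) (Fact.out : p.Prime).one_lt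
  subst hA
  have hX : ¬ A.charpoly ∣ X := fun h => by
    have h1 := (dvd_sub_right (h.trans (dvd_pow_self X (by omega : p ^ r - 1 ≠ 0)))).1 hG1
    exact hirr.not_isUnit (isUnit_of_dvd_one h1)
  have hb_zero : b 0 = 0 := by simp [hb]
  have hb_pos : ∀ t, 0 < t → t < p ^ r → b t = (A ^ (t - 1)) *ᵥ b₀ := fun t ht htq => by
    rw [hb, if_neg (Nat.not_dvd_of_pos_of_lt ht htq), Nat.mod_eq_of_lt htq]
  have hb_ne : ∀ t, 0 < t → t < p ^ r → b t ≠ 0 := fun t ht htq => by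
    have h := aeval_mulVec_ne_zero_of_irreducible_charpoly hirr (g := X ^ (t - 1))
      (fun h => hX (hirr.prime.dvd_of_dvd_pow h)) hb₀
    rwa [map_pow, aeval_X, ← hb_pos t ht htq] at h
  have hb_inj : Set.InjOn b (Finset.range (p ^ r)) := by
    intro t ht u hu h
    have ht' : t < p ^ r := Finset.mem_range.1 ht
    have hu' : u < p ^ r := Finset.mem_range.1 hu
    rcases Nat.eq_zero_or_pos t with rfl | ht0 <;> rcases Nat.eq_zero_or_pos u with rfl | hu0
    · rfl
    · exact absurd (h.symm.trans hb_zero) (hb_ne u hu0 hu')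
    · exact absurd (h.trans hb_zero) (hb_ne t ht0 ht')
    · rw [hb_pos t ht0 ht', hb_pos u hu0 hu'] at h
      have := pow_mulVec_injOn hirr hX hG2 hb₀ (Set.mem_Iio.2 (by omega : t - 1 < p ^ r - 1))
        (Set.mem_Iio.2 (by omega : u - 1 < p ^ r - 1)) h
      omega
  have hb_image : (Finset.range (p ^ r)).image b = Finset.univ := by
    rw [← Finset.card_eq_iff_eq_univ, Finset.card_image_of_injOn hb_inj]
    simp [ZMod.card]
  have hcoll : ∀ t, j t s = j t s' ↔ (α s - α s') ⬝ᵥ b t = j₀ s' - j₀ s := fun t => by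
    rw [hj, hj, sub_dotProduct]
    change j₀ s + α s ⬝ᵥ b t = j₀ s' + α s' ⬝ᵥ b t ↔ _
    constructor <;> intro h <;> linear_combination h
  simp only [hcoll]
  split_ifs with hα
  · have hj₀ : j₀ s' - j₀ s ≠ 0 := fun h =>
      hss' (hinj (Prod.ext (sub_eq_zero.1 h).symm hα))
    simp [hα, hj₀.symm]
  · have hcard := card_dotProduct_eq (sub_ne_zero.2 hα) (j₀ s' - j₀ s)
    rwa [← hb_image, Finset.filter_image, ZMod.card,
      Finset.card_image_of_injOn (hb_inj.mono (Finset.coe_subset.2 (Finset.filter_subset _ _)))]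
      at hcard
end
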